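/- For every integer n ≥ 3 and every vertex u ∈ V, the expected degree of u in the UTSW random graph G(c) satisfies E[δ_{G(c)}(u)] ≤ 6, where δ_{G(c)}(u) is the number of vertices adjacent to u in G(c). -/

import Mathlib

open scoped Classical
open Finset

/-- Vertex set of the `n × n` torus. -/
abbrev Vx (n : ℕ) := Fin n × Fin n

/-- Toroidal distance on the `n × n` torus. -/
def tdist (n : ℕ) (u v : Vx n) : ℕ :=
  min ((u.1 : ℤ) - (v.1 : ℤ)).natAbs (n - ((u.1 : ℤ) - (v.1 : ℤ)).natAbs) +
  min ((u.2 : ℤ) - (v.2 : ℤ)).natAbs (n - ((u.2 : ℤ) - (v.2 : ℤ)).natAbs)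

/-- The normalizing factor at vertex `u`. -/
noncomputable def Zfac (n : ℕ) (u : Vx n) : ℝ :=
  (∑ w ∈ univ.filter (fun w => w ≠ u), ((tdist n u w : ℝ) ^ 2)⁻¹)⁻¹

/-- The probability mass of the outcome `c : V → V` (the vector of long-range choices)
under the UTSW product measure: each vertex `u` independently chooses `c u = v ≠ u`
with probability `Z · d(u,v)⁻²`. -/
noncomputable def mass (n : ℕ) (c : Vx n → Vx n) : ℝ :=
  ∏ u : Vx n, if c u = u then 0 else Zfac n u * ((tdist n u (c u) : ℝ) ^ 2)⁻¹

/-- Probability of an event under the UTSW product measure. -/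
noncomputable def Pr (n : ℕ) (E : Set (Vx n → Vx n)) : ℝ :=
  ∑ c : Vx n → Vx n, if c ∈ E then mass n c else 0

/-- `{x, y}` is an edge of the UTSW random graph `G(c)`. -/
def isEdge (n : ℕ) (c : Vx n → Vx n) (x y : Vx n) : Prop :=
  x ≠ y ∧ (tdist n x y = 1 ∨ c x = y ∨ c y = x)

/-- `{x, y}` is an edge of `G(c)` of the given kind: local (`w = false`, distance one)
or long-range (`w = true`, distance not one). -/
def edgeKind (n : ℕ) (c : Vx n → Vx n) (x y : Vx n) (w : Bool) : Prop :=
  isEdge n c x y ∧ (tdist n x y = 1 ↔ w = false)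

/-- There is a four-cycle rooted at `u` in `G(c)` whose edge sequence has the local/long-range
pattern `(p₁, p₂, p₃, p₄)` (`false` = local edge, `true` = long-range edge). -/
def cyclePat (n : ℕ) (c : Vx n → Vx n) (u : Vx n) (p₁ p₂ p₃ p₄ : Bool) : Prop :=
  ∃ a b e : Vx n, a ≠ b ∧ a ≠ e ∧ b ≠ e ∧ a ≠ u ∧ b ≠ u ∧ e ≠ u ∧
    edgeKind n c u a p₁ ∧ edgeKind n c a b p₂ ∧ edgeKind n c b e p₃ ∧ edgeKind n c e u p₄

/-- `ζ(3) = ∑_{i ≥ 1} i⁻³`. -/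
noncomputable def zeta3 : ℝ := ∑' i : ℕ, ((i + 1 : ℝ) ^ 3)⁻¹

/-- Distance on the cycle of length `n`. -/
def cycleDist (n : ℕ) (a b : Fin n) : ℕ :=
  min ((a : ℤ) - (b : ℤ)).natAbs (n - ((a : ℤ) - (b : ℤ)).natAbs)

lemma tdist_eq_cycleDist_add (n : ℕ) (u v : Vx n) :
    tdist n u v = cycleDist n u.1 v.1 + cycleDist n u.2 v.2 := rfl

lemma cycleDist_comm (n : ℕ) (a b : Fin n) : cycleDist n a b = cycleDist n b a := by
  unfold cycleDist
  omega

lemma tdist_comm (n : ℕ) (u v : Vx n) : tdist n u v = tdist n v u := by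
  simp only [tdist_eq_cycleDist_add, cycleDist_comm n u.1, cycleDist_comm n u.2]

lemma cycleDist_add_right (n : ℕ) [NeZero n] (a b t : Fin n) :
    cycleDist n (a + t) (b + t) = cycleDist n a b := by
  have ha := a.isLt
  have hb := b.isLt
  have ht := t.isLt
  unfold cycleDist
  rw [Fin.val_add_eq_ite, Fin.val_add_eq_ite]
  split_ifs <;> omega

lemma tdist_add_right (n : ℕ) [NeZero n] (u v t : Vx n) :
    tdist n (u + t) (v + t) = tdist n u v := by
  simp only [tdist_eq_cycleDist_add, Prod.fst_add, Prod.snd_add, cycleDist_add_right]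

lemma eq_of_cycleDist_eq_zero (n : ℕ) (a b : Fin n) (h : cycleDist n a b = 0) : b = a := by
  have ha := a.isLt
  have hb := b.isLt
  unfold cycleDist at h
  ext
  omega

lemma eq_or_eq_of_cycleDist_eq_one (n : ℕ) [NeZero n] (hn : 1 < n) (a b : Fin n)
    (h : cycleDist n a b = 1) : b = a + 1 ∨ b = a - 1 := by
  have ha := a.isLt
  have hb := b.isLt
  have h1 : ((1 : Fin n) : ℕ) = 1 := by
    rw [Fin.val_one', Nat.mod_eq_of_lt hn]
  rw [eq_sub_iff_add_eq, Fin.ext_iff, Fin.ext_iff, Fin.val_add_eq_ite, Fin.val_add_eq_ite, h1]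
  unfold cycleDist at h
  split_ifs <;> omega

lemma card_tdist_eq_one_le (n : ℕ) (hn : 1 < n) (u : Vx n) :
    #{v : Vx n | tdist n u v = 1} ≤ 4 := by
  have : NeZero n := ⟨by omega⟩
  have hsub : ({v : Vx n | tdist n u v = 1} : Finset (Vx n)) ⊆
      {(u.1, u.2 + 1), (u.1, u.2 - 1), (u.1 + 1, u.2), (u.1 - 1, u.2)} := by
    rintro ⟨a, b⟩ h
    rw [mem_filter, tdist_eq_cycleDist_add, Nat.add_eq_one_iff] at h
    simp only [mem_insert, mem_singleton, Prod.mk.injEq]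
    rcases h.2 with ⟨h0, h1⟩ | ⟨h1, h0⟩ <;>
      have h0 := eq_of_cycleDist_eq_zero n _ _ h0 <;>
      have h1 := eq_or_eq_of_cycleDist_eq_one n hn _ _ h1 <;> tauto
  exact (card_le_card hsub).trans card_le_four

lemma Zfac_eq (n : ℕ) (u v : Vx n) : Zfac n u = Zfac n v := by
  have : NeZero n := ⟨by have := u.1.isLt; omega⟩
  unfold Zfac
  congr 1
  refine sum_equiv (Equiv.addRight (v - u)) (fun w => ?_) (fun w _ => ?_)
  · simp only [mem_filter, mem_univ, true_and, Equiv.coe_addRight, ne_eq]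
    rw [← eq_sub_iff_add_eq, sub_sub_cancel]
  · rw [← tdist_add_right n u w (v - u), add_sub_cancel, Equiv.coe_addRight]

/-- The probability that `u` chooses `v`. -/
noncomputable def choiceProb (n : ℕ) (u v : Vx n) : ℝ :=
  if v = u then 0 else Zfac n u * ((tdist n u v : ℝ) ^ 2)⁻¹

lemma mass_eq_prod_choiceProb (n : ℕ) (c : Vx n → Vx n) :
    mass n c = ∏ u, choiceProb n u (c u) := rfl

lemma choiceProb_nonneg (n : ℕ) (u v : Vx n) : 0 ≤ choiceProb n u v := by
  unfold choiceProb Zfac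
  split_ifs <;> positivity

lemma choiceProb_comm (n : ℕ) (u v : Vx n) : choiceProb n u v = choiceProb n v u := by
  unfold choiceProb
  rw [Zfac_eq n u v, tdist_comm n u v]
  simp only [eq_comm]

lemma sum_choiceProb_le_one (n : ℕ) (u : Vx n) : ∑ v, choiceProb n u v ≤ 1 := by
  have h : ∑ v, choiceProb n u v =
      Zfac n u * ∑ w ∈ univ.filter (fun w => w ≠ u), ((tdist n u w : ℝ) ^ 2)⁻¹ := by
    rw [mul_sum, sum_filter]
    refine sum_congr rfl fun v _ => ?_
    by_cases hv : v = u <;> simp [choiceProb, hv]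
  rw [h]
  exact inv_mul_le_one

lemma mass_nonneg (n : ℕ) (c : Vx n → Vx n) : 0 ≤ mass n c :=
  prod_nonneg fun u _ => choiceProb_nonneg n u (c u)

lemma sum_mass_le_one (n : ℕ) : ∑ c, mass n c ≤ 1 := by
  simp only [mass_eq_prod_choiceProb]
  rw [← Fintype.prod_sum]
  exact prod_le_one (fun u _ => sum_nonneg fun v _ => choiceProb_nonneg n u v)
    fun u _ => sum_choiceProb_le_one n u

lemma sum_mass_mul_indicator_le (n : ℕ) (v u : Vx n) :
    ∑ c, mass n c * (if c v = u then 1 else 0) ≤ choiceProb n v u := by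
  have h : ∀ c : Vx n → Vx n, mass n c * (if c v = u then 1 else 0) =
      ∏ w, choiceProb n w (c w) * (if w = v then (if c w = u then 1 else 0) else 1) := by
    intro c
    rw [prod_mul_distrib, prod_ite_eq' univ v, if_pos (mem_univ v), mass_eq_prod_choiceProb]
  simp only [h]
  rw [← Fintype.prod_sum (fun w x =>
    choiceProb n w x * (if w = v then (if x = u then 1 else 0) else 1)),
    ← mul_prod_erase univ _ (mem_univ v)]
  refine (mul_le_of_le_one_right ?_ (prod_le_one (fun w hw => ?_) fun w hw => ?_)).trans ?_
  · simp [choiceProb_nonneg]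
  · simp [ne_of_mem_erase hw, sum_nonneg, choiceProb_nonneg]
  · simp [ne_of_mem_erase hw, sum_choiceProb_le_one]
  · simp

lemma card_isEdge_le (n : ℕ) (hn : 1 < n) (c : Vx n → Vx n) (u : Vx n) :
    #{v : Vx n | isEdge n c u v} ≤ 5 + #{v : Vx n | c v = u} := by
  have hsub : ({v : Vx n | isEdge n c u v} : Finset (Vx n)) ⊆
      (({v : Vx n | tdist n u v = 1} : Finset (Vx n)) ∪ {c u}) ∪
        ({v : Vx n | c v = u} : Finset (Vx n)) := by
    intro v hv
    obtain ⟨-, h | h | h⟩ := (mem_filter.mp hv).2 <;> simp [h]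
  have h1 := card_le_card hsub
  have h2 := card_union_le (({v : Vx n | tdist n u v = 1} : Finset (Vx n)) ∪ {c u})
    {v : Vx n | c v = u}
  have h3 := card_union_le ({v : Vx n | tdist n u v = 1} : Finset (Vx n)) {c u}
  have h4 := card_tdist_eq_one_le n hn u
  rw [card_singleton] at h3
  omega

/-- The expected degree of any vertex `u` in the UTSW random graph is at most `6`. -/
theorem expected_degree_le_six :
    ∀ n : ℕ, 3 ≤ n → ∀ u : Vx n,
      (∑ c : Vx n → Vx n, mass n c *
        ((univ.filter (fun v : Vx n => isEdge n c u v)).card : ℝ)) ≤ 6 := by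
  intro n hn u
  calc _ ≤ ∑ c : Vx n → Vx n, mass n c * (5 + ∑ v, (if c v = u then 1 else 0)) := by
        refine sum_le_sum fun c _ => mul_le_mul_of_nonneg_left ?_ (mass_nonneg n c)
        rw [sum_boole]
        exact_mod_cast card_isEdge_le n (by omega) c u
    _ = (∑ c, mass n c) * 5 + ∑ v, ∑ c, mass n c * (if c v = u then 1 else 0) := by
        rw [sum_comm, sum_mul, ← sum_add_distrib]
        simp only [mul_add, mul_sum]
    _ ≤ 1 * 5 + ∑ v, choiceProb n u v := by
        gcongr with v
        · exact sum_mass_le_one n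
        · exact (sum_mass_mul_indicator_le n v u).trans_eq (choiceProb_comm n v u)
    _ ≤ 6 := by linarith [sum_choiceProb_le_one n u]
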